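/- arXiv:1511.02381 — 3 statements merged into one kernel-verified Lean document; each statement's English description precedes it below -/
import Mathlib

section
/- For every ε with 0 < ε < I(X;Y), the rate-privacy function satisfies ε·H(Y)/I(X;Y) ≤ g_ε(X;Y) ≤ H(Y|X) + ε. Moreover, the map ε ↦ g_ε(X;Y)/ε is non-increasing on (0,∞). -/
open scoped BigOperators

noncomputable section

namespace RatePrivacy

variable {α β γ : Type*}

/-- `p` is a probability mass function on a finite alphabet. -/
def IsPMF [Fintype α] (p : α → ℝ) : Prop := (∀ a, 0 ≤ p a) ∧ ∑ a, p a = 1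

/-- Shannon entropy (in bits) of the distribution `p`. -/
def ent [Fintype α] (p : α → ℝ) : ℝ := ∑ a, -(p a * Real.logb 2 (p a))

/-- First marginal of a joint distribution. -/
def margA [Fintype α] [Fintype β] (p : α × β → ℝ) : α → ℝ := fun a => ∑ b, p (a, b)

/-- Second marginal of a joint distribution. -/
def margB [Fintype α] [Fintype β] (p : α × β → ℝ) : β → ℝ := fun b => ∑ a, p (a, b)

/-- Mutual information (in bits) of a joint distribution `p`:
`I(A;B) = H(A) + H(B) - H(A,B)`. -/
def mi [Fintype α] [Fintype β] (p : α × β → ℝ) : ℝ :=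
  ent (margA p) + ent (margB p) - ent p

/-- `q` is a (row-stochastic) channel. -/
def IsChannel [Fintype γ] (q : β → γ → ℝ) : Prop :=
  (∀ y z, 0 ≤ q y z) ∧ ∀ y, ∑ z, q y z = 1

/-- Joint distribution of `(X, Z)` when `Z` is obtained from `Y` through the channel `q`
(so that `X — Y — Z` is a Markov chain). -/
def jointXZ [Fintype α] [Fintype β] [Fintype γ] (p : α × β → ℝ) (q : β → γ → ℝ) :
    α × γ → ℝ := fun xz => ∑ y, p (xz.1, y) * q y xz.2

/-- Joint distribution of `(Y, Z)` when `Z` is obtained from `Y` through the channel `q`. -/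
def jointYZ [Fintype α] [Fintype β] [Fintype γ] (p : α × β → ℝ) (q : β → γ → ℝ) :
    β × γ → ℝ := fun yz => margB p yz.1 * q yz.1 yz.2

/-- Achievable rates `I(Y;Z)` over all privacy filters `Z` (on finite alphabets, wlog `Fin n`)
with `X — Y — Z` Markov and `I(X;Z) ≤ ε`. -/
def gSet [Fintype α] [Fintype β] (p : α × β → ℝ) (ε : ℝ) : Set ℝ :=
  { r | ∃ (n : ℕ) (q : β → Fin n → ℝ), IsChannel q ∧
        mi (jointXZ p q) ≤ ε ∧ r = mi (jointYZ p q) }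

/-- The rate-privacy function `g_ε(X;Y)` (privacy measured by mutual information). -/
def g [Fintype α] [Fintype β] (p : α × β → ℝ) (ε : ℝ) : ℝ := sSup (gSet p ε)

/-- Values `E[f(A) g(B)]` over all zero-mean unit-variance `f, g`, used to define
the Hirschfeld–Gebelein–Rényi maximal correlation. -/
def corrSet [Fintype α] [Fintype β] (p : α × β → ℝ) : Set ℝ :=
  { r | ∃ (f : α → ℝ) (g : β → ℝ),
      (∑ a, margA p a * f a = 0) ∧ (∑ b, margB p b * g b = 0) ∧
      (∑ a, margA p a * (f a) ^ 2 = 1) ∧ (∑ b, margB p b * (g b) ^ 2 = 1) ∧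
      r = ∑ x : α × β, p x * (f x.1 * g x.2) }

/-- Maximal correlation `ρ_m(A;B)` (equal to `0` when the constraint set is empty,
since `sSup ∅ = 0` in `ℝ`). -/
def rhoM [Fintype α] [Fintype β] (p : α × β → ℝ) : ℝ := sSup (corrSet p)

/-- Achievable rates with maximal-correlation privacy constraint `ρ_m²(X;Z) ≤ ε`. -/
def ghSet [Fintype α] [Fintype β] (p : α × β → ℝ) (ε : ℝ) : Set ℝ :=
  { r | ∃ (n : ℕ) (q : β → Fin n → ℝ), IsChannel q ∧
        (rhoM (jointXZ p q)) ^ 2 ≤ ε ∧ r = mi (jointYZ p q) }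

/-- The rate-privacy function `ĝ_ε(X;Y)` (privacy measured by squared maximal correlation). -/
def gh [Fintype α] [Fintype β] (p : α × β → ℝ) (ε : ℝ) : ℝ := sSup (ghSet p ε)

/-- The Kullback–Leibler divergence (in bits) `D(P_{X|Y}(·|y) ‖ P_X)`. -/
def Dxy [Fintype α] [Fintype β] (p : α × β → ℝ) (y : β) : ℝ :=
  ∑ x, (p (x, y) / margB p y) * Real.logb 2 ((p (x, y) / margB p y) / margA p x)

/-- The entropy contribution of a single mass. -/
def entTerm (x : ℝ) : ℝ := -(x * Real.logb 2 x)

lemma ent_eq_sum_entTerm [Fintype α] (p : α → ℝ) : ent p = ∑ a, entTerm (p a) := rfl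

@[simp] lemma entTerm_zero : entTerm 0 = 0 := by simp [entTerm]

@[simp] lemma entTerm_one : entTerm 1 = 0 := by simp [entTerm]

lemma entTerm_mul (x y : ℝ) : entTerm (x * y) = y * entTerm x + x * entTerm y := by
  rcases eq_or_ne x 0 with rfl | hx
  · simp
  rcases eq_or_ne y 0 with rfl | hy
  · simp
  rw [entTerm, entTerm, entTerm, Real.logb_mul hx hy]
  ring

lemma entTerm_sum_le {ι : Type*} (s : Finset ι) (f : ι → ℝ) (hf : ∀ i ∈ s, 0 ≤ f i) :
    entTerm (∑ i ∈ s, f i) ≤ ∑ i ∈ s, entTerm (f i) := by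
  simp only [entTerm]
  rw [Finset.sum_neg_distrib, Finset.sum_mul]
  refine neg_le_neg (Finset.sum_le_sum fun i hi => ?_)
  rcases (hf i hi).eq_or_lt with h | h
  · simp [← h]
  · exact mul_le_mul_of_nonneg_left
      (Real.logb_le_logb_of_le one_lt_two h (Finset.single_le_sum hf hi)) h.le

/-- The joint law of `(A, B')`, where `B'` reveals `B` with probability `t` and is an erasure
symbol otherwise. -/
def erase {n : ℕ} [Fintype α] (t : ℝ) (r : α × Fin n → ℝ) : α × Fin (n + 1) → ℝ :=
  fun x => Fin.lastCases (motive := fun _ => ℝ) ((1 - t) * margA r x.1)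
    (fun i => t * r (x.1, i)) x.2

lemma mi_erase {n : ℕ} [Fintype α] (t : ℝ) (r : α × Fin n → ℝ) (hr : ∑ x, r x = 1) :
    mi (erase t r) = t * mi r := by
  have hA : margA (erase t r) = margA r := by
    funext a
    simp only [margA, erase, Fin.sum_univ_castSucc, Fin.lastCases_castSucc, Fin.lastCases_last,
      ← Finset.mul_sum]
    ring
  have hsA : ∑ a, margA r a = 1 := by rw [← hr, Fintype.sum_prod_type]; rfl
  have hsB : ∑ i, margB r i = 1 := by rw [← hr, Fintype.sum_prod_type_right]; rfl
  have hB : ent (margB (erase t r)) = entTerm t + t * ent (margB r) + entTerm (1 - t) := by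
    have h (i : Fin n) : margB (erase t r) i.castSucc = t * margB r i := by
      simp [margB, erase, Finset.mul_sum]
    have hl : margB (erase t r) (Fin.last n) = 1 - t := by
      simp [margB, erase, ← Finset.mul_sum, hsA]
    simp only [ent_eq_sum_entTerm, Fin.sum_univ_castSucc, h, hl, entTerm_mul,
      Finset.sum_add_distrib, ← Finset.mul_sum, ← Finset.sum_mul, hsB]
    ring
  have hAB : ent (erase t r) =
      entTerm t + t * ent r + (entTerm (1 - t) + (1 - t) * ent (margA r)) := by
    have hr' : ∑ a, ∑ i, r (a, i) = 1 := by rw [← hr, Fintype.sum_prod_type]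
    simp only [ent_eq_sum_entTerm, Fintype.sum_prod_type, Fin.sum_univ_castSucc, erase,
      Fin.lastCases_castSucc, Fin.lastCases_last, entTerm_mul,
      Finset.sum_add_distrib, ← Finset.mul_sum, ← Finset.sum_mul, hsA, hr']
    ring
  rw [mi, hA, hB, hAB, mi]
  ring

/-- The channel that applies `q` with probability `t` and erases its output otherwise. -/
def eraseChannel {n : ℕ} (t : ℝ) (q : β → Fin n → ℝ) : β → Fin (n + 1) → ℝ :=
  fun y z => Fin.lastCases (motive := fun _ => ℝ) (1 - t) (fun i => t * q y i) z

lemma IsChannel.eraseChannel {n : ℕ} {q : β → Fin n → ℝ} (hq : IsChannel q) {t : ℝ}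
    (h0 : 0 ≤ t) (h1 : t ≤ 1) : IsChannel (eraseChannel t q) := by
  refine ⟨fun y z => ?_, fun y => ?_⟩
  · refine Fin.lastCases ?_ (fun i => ?_) z
    · simpa [RatePrivacy.eraseChannel] using h1
    · simpa [RatePrivacy.eraseChannel] using mul_nonneg h0 (hq.1 y i)
  · simp [RatePrivacy.eraseChannel, Fin.sum_univ_castSucc, ← Finset.mul_sum, hq.2]

section Channel

variable [Fintype α] [Fintype β] [Fintype γ]

lemma margA_jointXZ (p : α × β → ℝ) {q : β → γ → ℝ} (hq : IsChannel q) :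
    margA (jointXZ p q) = margA p := by
  funext a
  simp only [margA, jointXZ]
  rw [Finset.sum_comm]
  simp [← Finset.mul_sum, hq.2]

lemma margA_jointYZ (p : α × β → ℝ) {q : β → γ → ℝ} (hq : IsChannel q) :
    margA (jointYZ p q) = margB p := by
  funext a
  simp [margA, jointYZ, ← Finset.mul_sum, hq.2]

lemma margB_jointXZ (p : α × β → ℝ) (q : β → γ → ℝ) :
    margB (jointXZ p q) = margB (jointYZ p q) := by
  funext z
  simp only [margB, jointXZ, jointYZ, Finset.sum_mul]
  exact Finset.sum_comm

lemma sum_jointXZ {p : α × β → ℝ} (hp : IsPMF p) {q : β → γ → ℝ} (hq : IsChannel q) :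
    ∑ x, jointXZ p q x = 1 := by
  have h : ∑ x, jointXZ p q x = ∑ a, margA (jointXZ p q) a := Fintype.sum_prod_type _
  rw [h, margA_jointXZ p hq, ← hp.2, Fintype.sum_prod_type]
  rfl

lemma sum_jointYZ {p : α × β → ℝ} (hp : IsPMF p) {q : β → γ → ℝ} (hq : IsChannel q) :
    ∑ x, jointYZ p q x = 1 := by
  have h : ∑ x, jointYZ p q x = ∑ a, margA (jointYZ p q) a := Fintype.sum_prod_type _
  rw [h, margA_jointYZ p hq, ← hp.2, Fintype.sum_prod_type_right]
  rfl

lemma jointXZ_eraseChannel {n : ℕ} (p : α × β → ℝ) {q : β → Fin n → ℝ} (hq : IsChannel q)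
    (t : ℝ) : jointXZ p (eraseChannel t q) = erase t (jointXZ p q) := by
  funext ⟨a, z⟩
  refine Fin.lastCases ?_ (fun i => ?_) z
  · have h : erase t (jointXZ p q) (a, Fin.last n) = (1 - t) * margA p a := by
      simp [erase, margA_jointXZ p hq]
    rw [h]
    simp [jointXZ, eraseChannel, margA, Finset.mul_sum, mul_comm]
  · simp [jointXZ, eraseChannel, erase, Finset.mul_sum, mul_left_comm]

lemma jointYZ_eraseChannel {n : ℕ} (p : α × β → ℝ) {q : β → Fin n → ℝ} (hq : IsChannel q)
    (t : ℝ) : jointYZ p (eraseChannel t q) = erase t (jointYZ p q) := by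
  funext ⟨a, z⟩
  refine Fin.lastCases ?_ (fun i => ?_) z
  · simp [jointYZ, eraseChannel, erase, margA_jointYZ p hq, mul_comm]
  · simp [jointYZ, eraseChannel, erase, mul_left_comm]

/-- Random erasure scales both the rate and the leakage. -/
lemma mul_mem_gSet {p : α × β → ℝ} (hp : IsPMF p) {ε r t : ℝ} (hr : r ∈ gSet p ε)
    (h0 : 0 ≤ t) (h1 : t ≤ 1) : t * r ∈ gSet p (t * ε) := by
  obtain ⟨n, q, hq, hε, rfl⟩ := hr
  refine ⟨n + 1, eraseChannel t q, hq.eraseChannel h0 h1, ?_, ?_⟩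
  · rw [jointXZ_eraseChannel p hq, mi_erase t _ (sum_jointXZ hp hq)]
    exact mul_le_mul_of_nonneg_left hε h0
  · rw [jointYZ_eraseChannel p hq, mi_erase t _ (sum_jointYZ hp hq)]

/-- For a Markov chain `X — Y — Z`, `H(Y) + H(X,Z) ≤ H(X,Y) + H(Y,Z)`. -/
lemma ent_margB_add_ent_jointXZ_le {p : α × β → ℝ} (hp : IsPMF p) {q : β → γ → ℝ}
    (hq : IsChannel q) :
    ent (margB p) + ent (jointXZ p q) ≤ ent p + ent (jointYZ p q) := by
  have hXZ : ent (jointXZ p q) ≤ ∑ x, ∑ z, ∑ y, entTerm (p (x, y) * q y z) := by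
    rw [ent_eq_sum_entTerm, Fintype.sum_prod_type]
    exact Finset.sum_le_sum fun x _ => Finset.sum_le_sum fun z _ =>
      entTerm_sum_le _ _ fun y _ => mul_nonneg (hp.1 _) (hq.1 _ _)
  have hXYZ : ∑ x, ∑ z, ∑ y, entTerm (p (x, y) * q y z) =
      ent p + ∑ y, margB p y * ent (q y) := by
    have h (x : α) : ∑ z, ∑ y, entTerm (p (x, y) * q y z) =
        ∑ y, entTerm (p (x, y)) + ∑ y, p (x, y) * ent (q y) := by
      rw [Finset.sum_comm, ← Finset.sum_add_distrib]
      refine Finset.sum_congr rfl fun y _ => ?_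
      simp only [entTerm_mul, Finset.sum_add_distrib, ← Finset.sum_mul, ← Finset.mul_sum, hq.2,
        one_mul, ent_eq_sum_entTerm]
    simp only [h, Finset.sum_add_distrib, margB, Finset.sum_mul]
    rw [ent_eq_sum_entTerm p, Fintype.sum_prod_type]
    congr 1
    exact Finset.sum_comm
  have hYZ : ent (jointYZ p q) = ent (margB p) + ∑ y, margB p y * ent (q y) := by
    simp only [ent_eq_sum_entTerm, Fintype.sum_prod_type, jointYZ, entTerm_mul,
      Finset.sum_add_distrib, ← Finset.sum_mul, ← Finset.mul_sum, hq.2, one_mul]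
  linarith

lemma le_of_mem_gSet {p : α × β → ℝ} (hp : IsPMF p) {ε r : ℝ} (hr : r ∈ gSet p ε) :
    r ≤ (ent p - ent (margA p)) + ε := by
  obtain ⟨n, q, hq, hε, rfl⟩ := hr
  have h := ent_margB_add_ent_jointXZ_le hp hq
  rw [mi, margA_jointXZ p hq, margB_jointXZ] at hε
  rw [mi, margA_jointYZ p hq]
  linarith

lemma bddAbove_gSet {p : α × β → ℝ} (hp : IsPMF p) (ε : ℝ) : BddAbove (gSet p ε) :=
  ⟨_, fun _ hr => le_of_mem_gSet hp hr⟩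

/-- Disclosing `Y` itself has rate `H(Y)` and leakage `I(X;Y)`. -/
lemma ent_margB_mem_gSet (p : α × β → ℝ) : ent (margB p) ∈ gSet p (mi p) := by
  classical
  let e := Fintype.equivFin β
  let q : β → Fin (Fintype.card β) → ℝ := fun y z => if e y = z then 1 else 0
  have hq : IsChannel q :=
    ⟨fun y z => by dsimp only [q]; split_ifs <;> norm_num, fun y => by simp [q]⟩
  have hYZ : margB (jointYZ p q) = fun z => margB p (e.symm z) := by
    funext z
    simp [margB, jointYZ, q, ← Equiv.eq_symm_apply]
  have hentB : ent (margB (jointYZ p q)) = ent (margB p) := by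
    rw [hYZ]
    exact e.symm.sum_comp fun y => entTerm (margB p y)
  have hXZ : jointXZ p q = fun x => p (x.1, e.symm x.2) := by
    funext x
    simp [jointXZ, q, ← Equiv.eq_symm_apply]
  have hentXZ : ent (jointXZ p q) = ent p := by
    rw [hXZ]
    simp only [ent_eq_sum_entTerm, Fintype.sum_prod_type]
    exact Finset.sum_congr rfl fun x _ => e.symm.sum_comp fun y => entTerm (p (x, y))
  have hentYZ : ent (jointYZ p q) = ent (margB p) := by
    simp only [ent_eq_sum_entTerm, Fintype.sum_prod_type]
    refine Finset.sum_congr rfl fun y _ => ?_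
    rw [Finset.sum_eq_single (e y)]
    · simp [jointYZ, q]
    · intro z _ hz
      simp [jointYZ, q, hz.symm]
    · simp
  refine ⟨_, q, hq, ?_, ?_⟩
  · rw [mi, margA_jointXZ p hq, margB_jointXZ, hentB, hentXZ, mi]
  · rw [mi, margA_jointYZ p hq, hentB, hentYZ]
    ring

/-- A constant `Z` has zero rate and zero leakage. -/
lemma zero_mem_gSet {p : α × β → ℝ} (hp : IsPMF p) {ε : ℝ} (hε : 0 ≤ ε) :
    (0 : ℝ) ∈ gSet p ε := by
  have h := mul_mem_gSet hp (ent_margB_mem_gSet p) le_rfl zero_le_one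
  rw [zero_mul, zero_mul] at h
  obtain ⟨n, q, hq, hle, h⟩ := h
  exact ⟨n, q, hq, hle.trans hε, h⟩

end Channel

/-- For a joint pmf `p` of `(X,Y)` on finite alphabets with all `P_Y(y) > 0`
and `X, Y` not independent: for every `ε` with `0 < ε < I(X;Y)`,
`ε·H(Y)/I(X;Y) ≤ g_ε(X;Y) ≤ H(Y|X) + ε` (here `H(Y|X) = H(X,Y) - H(X)`), and the map
`ε ↦ g_ε(X;Y)/ε` is non-increasing on `(0,∞)`. -/
theorem stmt0 {𝓧 𝓨 : Type*} [Fintype 𝓧] [Fintype 𝓨]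
    (p : 𝓧 × 𝓨 → ℝ) (hp : IsPMF p)
    (hYpos : ∀ y, 0 < margB p y)
    (hdep : ¬ ∀ x y, p (x, y) = margA p x * margB p y) :
    (∀ ε : ℝ, 0 < ε → ε < mi p →
        ε * ent (margB p) / mi p ≤ g p ε ∧ g p ε ≤ (ent p - ent (margA p)) + ε) ∧
    (∀ ε₁ ε₂ : ℝ, 0 < ε₁ → ε₁ ≤ ε₂ → g p ε₂ / ε₂ ≤ g p ε₁ / ε₁) := by
  refine ⟨fun ε hε hlt => ⟨?_, ?_⟩, fun ε₁ ε₂ h₁ h₁₂ => ?_⟩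
  · have hmi : 0 < mi p := hε.trans hlt
    have h := mul_mem_gSet hp (ent_margB_mem_gSet p) (div_nonneg hε.le hmi.le)
      ((div_le_one hmi).2 hlt.le)
    rw [div_mul_cancel₀ _ hmi.ne'] at h
    rw [mul_div_right_comm]
    exact le_csSup (bddAbove_gSet hp ε) h
  · exact csSup_le ⟨0, zero_mem_gSet hp hε.le⟩ fun r hr => le_of_mem_gSet hp hr
  · have h₂ : 0 < ε₂ := h₁.trans_le h₁₂
    rw [div_le_iff₀ h₂]
    refine csSup_le ⟨0, zero_mem_gSet hp h₂.le⟩ fun r hr => ?_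
    have h := mul_mem_gSet hp hr (div_nonneg h₁.le h₂.le) ((div_le_one h₂).2 h₁₂)
    rw [div_mul_cancel₀ _ h₂.ne'] at h
    have h' : ε₁ / ε₂ * r ≤ g p ε₁ := le_csSup (bddAbove_gSet hp ε₁) h
    calc r = ε₁ / ε₂ * r / ε₁ * ε₂ := by field_simp
      _ ≤ g p ε₁ / ε₁ * ε₂ := by gcongr

end RatePrivacy
end
end

section
/- Let (X^n, Y^n) = ((X₁,Y₁),…,(Xₙ,Yₙ)) be n i.i.d. copies of a pair of discrete random variables (X,Y) on finite alphabets, and let J be any random variable on a finite alphabet jointly distributed with (X^n,Y^n). Then I(X^n;J) − I(Y^n;J) = Σ_{i=1}^n [ I(X_i;U_i) − I(Y_i;U_i) ], where U_i := (J, X_{i+1}^n, Y^{i-1}) with X_{i+1}^n = (X_{i+1},…,Xₙ) and Y^{i-1} = (Y₁,…,Y_{i-1}). -/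
open scoped BigOperators

noncomputable section

namespace RatePrivacy

variable {α β γ : Type*}

/-- Joint distribution of `(X_i, U_i)` where `U_i = (J, X_{i+1}^n, Y^{i-1})`, obtained by
marginalizing the joint distribution `P` of `((X^n, Y^n), J)`. -/
def jointXiU {𝓧 𝓨 𝓙 : Type*} [Fintype 𝓧] [Fintype 𝓨] [Fintype 𝓙]
    [DecidableEq 𝓧] [DecidableEq 𝓨] {n : ℕ}
    (P : ((Fin n → 𝓧) × (Fin n → 𝓨)) × 𝓙 → ℝ) (i : Fin n) :
    𝓧 × (𝓙 × ({k : Fin n // i < k} → 𝓧) × ({k : Fin n // k < i} → 𝓨)) → ℝ :=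
  fun z => ∑ x : Fin n → 𝓧, ∑ y : Fin n → 𝓨,
    if x i = z.1 ∧ (∀ k : {k : Fin n // i < k}, x k.1 = z.2.2.1 k) ∧
        (∀ k : {k : Fin n // k < i}, y k.1 = z.2.2.2 k)
    then P ((x, y), z.2.1) else 0

/-- Joint distribution of `(Y_i, U_i)` where `U_i = (J, X_{i+1}^n, Y^{i-1})`. -/
def jointYiU {𝓧 𝓨 𝓙 : Type*} [Fintype 𝓧] [Fintype 𝓨] [Fintype 𝓙]
    [DecidableEq 𝓧] [DecidableEq 𝓨] {n : ℕ}
    (P : ((Fin n → 𝓧) × (Fin n → 𝓨)) × 𝓙 → ℝ) (i : Fin n) :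
    𝓨 × (𝓙 × ({k : Fin n // i < k} → 𝓧) × ({k : Fin n // k < i} → 𝓨)) → ℝ :=
  fun z => ∑ x : Fin n → 𝓧, ∑ y : Fin n → 𝓨,
    if y i = z.1 ∧ (∀ k : {k : Fin n // i < k}, x k.1 = z.2.2.1 k) ∧
        (∀ k : {k : Fin n // k < i}, y k.1 = z.2.2.2 k)
    then P ((x, y), z.2.1) else 0

/-- The law of `f` under the finite weight `P`. -/
def push [Fintype α] (f : α → β) (P : α → ℝ) : β → ℝ :=
  open Classical in fun b => ∑ a, if f a = b then P a else 0

theorem sum_push_mul [Fintype α] [Fintype β] (f : α → β) (P : α → ℝ) (h : β → ℝ) :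
    ∑ b, push f P b * h b = ∑ a, P a * h (f a) := by
  classical
  simp only [push, Finset.sum_mul]
  rw [Finset.sum_comm]
  simp

theorem push_push [Fintype α] [Fintype β] (f : α → β) (g : β → γ) (P : α → ℝ) :
    push g (push f P) = push (fun a => g (f a)) P := by
  classical
  funext c
  have h := sum_push_mul f P (fun b => if g b = c then 1 else 0)
  simp only [mul_ite, mul_one, mul_zero] at h
  simpa only [push] using h

theorem margA_eq_push [Fintype α] [Fintype β] (p : α × β → ℝ) : margA p = push Prod.fst p := by
  classical
  funext a
  simp [margA, push, Fintype.sum_prod_type_right]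

theorem margB_eq_push [Fintype α] [Fintype β] (p : α × β → ℝ) : margB p = push Prod.snd p := by
  classical
  funext b
  simp [margB, push, Fintype.sum_prod_type]

/-- The entropy of `f` depends only on the partition of the sample space that `f` induces. -/
theorem ent_push_congr [Fintype α] [Fintype β] [Fintype γ] (f : α → β) (g : α → γ) (P : α → ℝ)
    (h : ∀ a b, f a = f b ↔ g a = g b) : ent (push f P) = ent (push g P) := by
  have hfg : ∀ a, push f P (f a) = push g P (g a) := fun a => by
    classical
    exact Finset.sum_congr rfl fun b _ => if_congr (h b a) rfl rfl
  simp only [ent, Finset.sum_neg_distrib]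
  rw [sum_push_mul f P fun b => Real.logb 2 (push f P b),
    sum_push_mul g P fun b => Real.logb 2 (push g P b)]
  simp only [hfg]

theorem sum_prod_mul_eval [Fintype α] {n : ℕ} (q : α → ℝ) (hq : ∑ a, q a = 1) (i : Fin n)
    (h : α → ℝ) : ∑ z : Fin n → α, (∏ k, q (z k)) * h (z i) = ∑ a, q a * h a := by
  have h₁ : ∀ z : Fin n → α, (∏ k, q (z k)) * h (z i)
      = ∏ k, q (z k) * (if k = i then h (z k) else 1) := fun z => by
    rw [Finset.prod_mul_distrib]
    simp
  simp only [h₁]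
  rw [← Fintype.prod_sum fun k a => q a * (if k = i then h a else 1),
    Finset.prod_eq_single i]
  · simp
  · intro k _ hk
    simp [hk, hq]
  · simp

theorem push_eval_prod [Fintype α] {n : ℕ} (q : α → ℝ) (hq : ∑ a, q a = 1) (i : Fin n) :
    push (fun z : Fin n → α => z i) (fun z => ∏ k, q (z k)) = q := by
  classical
  funext c
  simpa [push] using sum_prod_mul_eval q hq i fun a => if a = c then 1 else 0

/-- The entropy of `n` i.i.d. copies is `n` times the entropy of one. -/
theorem ent_prod [Fintype α] {n : ℕ} (q : α → ℝ) (hq : ∑ a, q a = 1) :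
    ent (fun z : Fin n → α => ∏ k, q (z k)) = ∑ _i : Fin n, ent q := by
  have h₁ : ∀ z : Fin n → α, (∏ k, q (z k)) * Real.logb 2 (∏ k, q (z k))
      = ∑ i, (∏ k, q (z k)) * Real.logb 2 (q (z i)) := fun z => by
    rw [← Finset.mul_sum]
    by_cases h : ∏ k, q (z k) = 0
    · simp [h]
    · rw [Real.logb_prod]
      exact fun i hi => Finset.prod_ne_zero_iff.mp h i hi
  simp only [ent, Finset.sum_neg_distrib, h₁]
  rw [Finset.sum_comm]
  simp only [fun i : Fin n => sum_prod_mul_eval q hq i fun a => Real.logb 2 (q a)]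

/-- For a joint law whose first coordinate is a block of i.i.d. letters with law `q`, the entropy
of the block is the sum of the entropies of the letters. -/
theorem ent_push_eq_sum [Fintype α] [Fintype β] {n : ℕ} (P : β → ℝ) (Z : β → Fin n → α)
    (q : α → ℝ) (hq : ∑ a, q a = 1) (hZ : push Z P = fun z => ∏ k, q (z k)) :
    ent (push Z P) = ∑ i, ent (push (fun b => Z b i) P) := by
  have h : ∀ i, push (fun b => Z b i) P = q := fun i => by
    rw [← push_push Z (fun z => z i), hZ, push_eval_prod q hq i]
  simp only [h]
  rw [hZ, ent_prod q hq]

section Blocks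

variable {𝓧 𝓨 𝓙 : Type*} {n : ℕ}

/-- The hybrid block made of `J`, the `Y`-letters before position `c` and the `X`-letters from
position `c` on. -/
def hybrid (c : ℕ) (a : ((Fin n → 𝓧) × (Fin n → 𝓨)) × 𝓙) :
    𝓙 × ({k : Fin n // c ≤ k.1} → 𝓧) × ({k : Fin n // k.1 < c} → 𝓨) :=
  (a.2, fun k => a.1.1 k.1, fun k => a.1.2 k.1)

theorem hybrid_eq_iff (c : ℕ) (a b : ((Fin n → 𝓧) × (Fin n → 𝓨)) × 𝓙) :
    hybrid c a = hybrid c b ↔ a.2 = b.2 ∧ (∀ k : Fin n, c ≤ k.1 → a.1.1 k = b.1.1 k) ∧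
      ∀ k : Fin n, k.1 < c → a.1.2 k = b.1.2 k := by
  simp [hybrid, funext_iff]

variable [Fintype 𝓧] [Fintype 𝓨] [Fintype 𝓙]

theorem jointXiU_eq_push [DecidableEq 𝓧] [DecidableEq 𝓨]
    (P : ((Fin n → 𝓧) × (Fin n → 𝓨)) × 𝓙 → ℝ) (i : Fin n) :
    jointXiU P i = push (fun a => (a.1.1 i, a.2, (fun k => a.1.1 k.1), fun k => a.1.2 k.1)) P := by
  classical
  funext ⟨c, j, u, v⟩
  simp only [jointXiU, push, Fintype.sum_prod_type, Prod.mk.injEq, funext_iff]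
  refine Finset.sum_congr rfl fun x _ => Finset.sum_congr rfl fun y _ => ?_
  rw [Finset.sum_eq_single j]
  · simp
  · intro b _ hb
    simp [hb]
  · simp

theorem jointYiU_eq_push [DecidableEq 𝓧] [DecidableEq 𝓨]
    (P : ((Fin n → 𝓧) × (Fin n → 𝓨)) × 𝓙 → ℝ) (i : Fin n) :
    jointYiU P i = push (fun a => (a.1.2 i, a.2, (fun k => a.1.1 k.1), fun k => a.1.2 k.1)) P := by
  classical
  funext ⟨c, j, u, v⟩
  simp only [jointYiU, push, Fintype.sum_prod_type, Prod.mk.injEq, funext_iff]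
  refine Finset.sum_congr rfl fun x _ => Finset.sum_congr rfl fun y _ => ?_
  rw [Finset.sum_eq_single j]
  · simp
  · intro b _ hb
    simp [hb]
  · simp

theorem sum_snd_eq_push (P : ((Fin n → 𝓧) × (Fin n → 𝓨)) × 𝓙 → ℝ) :
    (fun xj : (Fin n → 𝓧) × 𝓙 => ∑ y, P ((xj.1, y), xj.2)) = push (fun a => (a.1.1, a.2)) P := by
  classical
  funext ⟨x, j⟩
  simp only [push, Fintype.sum_prod_type, Prod.mk.injEq, ite_and]
  rw [Finset.sum_eq_single x]
  · simp
  · intro b _ hb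
    simp [hb]
  · simp

theorem sum_fst_eq_push (P : ((Fin n → 𝓧) × (Fin n → 𝓨)) × 𝓙 → ℝ) :
    (fun yj : (Fin n → 𝓨) × 𝓙 => ∑ x, P ((x, yj.1), yj.2)) = push (fun a => (a.1.2, a.2)) P := by
  classical
  funext ⟨y, j⟩
  simp only [push, Fintype.sum_prod_type, Prod.mk.injEq, ite_and]
  refine Finset.sum_congr rfl fun x _ => ?_
  rw [Finset.sum_eq_single y]
  · simp
  · intro b _ hb
    simp [hb]
  · simp

theorem ent_jointXiU [DecidableEq 𝓧] [DecidableEq 𝓨]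
    (P : ((Fin n → 𝓧) × (Fin n → 𝓨)) × 𝓙 → ℝ) (i : Fin n) :
    ent (jointXiU P i) = ent (push (hybrid i.1) P) := by
  rw [jointXiU_eq_push]
  refine ent_push_congr _ _ _ fun a b => ?_
  simp only [hybrid_eq_iff, Prod.mk.injEq, funext_iff, Subtype.forall, Fin.lt_def]
  constructor
  · rintro ⟨hi, hj, hx, hy⟩
    refine ⟨hj, fun k hk => ?_, hy⟩
    rcases hk.eq_or_lt with h | h
    · rwa [← Fin.ext h]
    · exact hx k h
  · rintro ⟨hj, hx, hy⟩
    exact ⟨hx i le_rfl, hj, fun k hk => hx k hk.le, hy⟩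

theorem ent_jointYiU [DecidableEq 𝓧] [DecidableEq 𝓨]
    (P : ((Fin n → 𝓧) × (Fin n → 𝓨)) × 𝓙 → ℝ) (i : Fin n) :
    ent (jointYiU P i) = ent (push (hybrid (i.1 + 1)) P) := by
  rw [jointYiU_eq_push]
  refine ent_push_congr _ _ _ fun a b => ?_
  simp only [hybrid_eq_iff, Prod.mk.injEq, funext_iff, Subtype.forall, Fin.lt_def]
  constructor
  · rintro ⟨hi, hj, hx, hy⟩
    refine ⟨hj, hx, fun k hk => ?_⟩
    rcases (Nat.lt_succ_iff.mp hk).eq_or_lt with h | h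
    · rwa [Fin.ext h]
    · exact hy k h
  · rintro ⟨hj, hx, hy⟩
    exact ⟨hy i (Nat.lt_succ_self _), hj, hx, fun k hk => hy k (Nat.lt_succ_of_lt hk)⟩

theorem ent_hybrid_zero (P : ((Fin n → 𝓧) × (Fin n → 𝓨)) × 𝓙 → ℝ) :
    ent (push (hybrid 0) P) = ent (push (fun a => (a.1.1, a.2)) P) :=
  ent_push_congr _ _ _ fun a b => by
    simp [hybrid_eq_iff, ← funext_iff, and_comm]

theorem ent_hybrid_last (P : ((Fin n → 𝓧) × (Fin n → 𝓨)) × 𝓙 → ℝ) :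
    ent (push (hybrid n) P) = ent (push (fun a => (a.1.2, a.2)) P) :=
  ent_push_congr _ _ _ fun a b => by
    have h : ∀ k : Fin n, ¬ n ≤ k.1 := fun k => k.2.not_ge
    simp [hybrid_eq_iff, ← funext_iff, and_comm, h]

theorem push_fst_eq_prod (p : 𝓧 × 𝓨 → ℝ) (P : ((Fin n → 𝓧) × (Fin n → 𝓨)) × 𝓙 → ℝ)
    (hiid : ∀ xy : (Fin n → 𝓧) × (Fin n → 𝓨), (∑ j, P (xy, j)) = ∏ i, p (xy.1 i, xy.2 i)) :
    push (fun a => a.1.1) P = fun x => ∏ k, margA p (x k) := by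
  funext x
  rw [← push_push Prod.fst Prod.fst, ← margA_eq_push P, ← margA_eq_push]
  simp only [margA, hiid]
  exact (Fintype.prod_sum fun k y => p (x k, y)).symm

theorem push_snd_eq_prod (p : 𝓧 × 𝓨 → ℝ) (P : ((Fin n → 𝓧) × (Fin n → 𝓨)) × 𝓙 → ℝ)
    (hiid : ∀ xy : (Fin n → 𝓧) × (Fin n → 𝓨), (∑ j, P (xy, j)) = ∏ i, p (xy.1 i, xy.2 i)) :
    push (fun a => a.1.2) P = fun y => ∏ k, margB p (y k) := by
  funext y
  rw [← push_push Prod.fst Prod.snd, ← margA_eq_push P, ← margB_eq_push]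
  simp only [margA, margB, hiid]
  exact (Fintype.prod_sum fun k x => p (x, y k)).symm

end Blocks

/-- Let `(X^n, Y^n)` be `n` i.i.d. copies of `(X,Y) ~ p`, and let `J` be any
random variable (on a finite alphabet) jointly distributed with `(X^n, Y^n)`.  Then
`I(X^n;J) − I(Y^n;J) = Σ_i [ I(X_i;U_i) − I(Y_i;U_i) ]` where
`U_i = (J, X_{i+1}^n, Y^{i-1})`. -/
theorem stmt8 {𝓧 𝓨 𝓙 : Type*} [Fintype 𝓧] [Fintype 𝓨] [Fintype 𝓙]
    [DecidableEq 𝓧] [DecidableEq 𝓨] {n : ℕ}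
    (p : 𝓧 × 𝓨 → ℝ) (hp : IsPMF p)
    (P : ((Fin n → 𝓧) × (Fin n → 𝓨)) × 𝓙 → ℝ) (hP : IsPMF P)
    (hiid : ∀ xy : (Fin n → 𝓧) × (Fin n → 𝓨),
      (∑ j, P (xy, j)) = ∏ i, p (xy.1 i, xy.2 i)) :
    mi (fun xj : (Fin n → 𝓧) × 𝓙 => ∑ y, P ((xj.1, y), xj.2))
      - mi (fun yj : (Fin n → 𝓨) × 𝓙 => ∑ x, P ((x, yj.1), yj.2))
    = ∑ i : Fin n, (mi (jointXiU P i) - mi (jointYiU P i)) := by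
  have hqX : ∑ a, margA p a = 1 := by rw [← hp.2, Fintype.sum_prod_type]; rfl
  have hqY : ∑ b, margB p b = 1 := by rw [← hp.2, Fintype.sum_prod_type_right]; rfl
  have hX := ent_push_eq_sum P (fun a => a.1.1) _ hqX (push_fst_eq_prod p P hiid)
  have hY := ent_push_eq_sum P (fun a => a.1.2) _ hqY (push_snd_eq_prod p P hiid)
  have hterm : ∀ i : Fin n, mi (jointXiU P i) - mi (jointYiU P i)
      = ent (push (fun a => a.1.1 i) P) - ent (push (fun a => a.1.2 i) P)
        + (ent (push (hybrid (i.1 + 1)) P) - ent (push (hybrid i.1) P)) := fun i => by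
    simp only [mi, ent_jointXiU, ent_jointYiU]
    simp only [margA_eq_push, margB_eq_push, jointXiU_eq_push, jointYiU_eq_push, push_push]
    ring
  have htel : ∑ i : Fin n, (ent (push (hybrid (i.1 + 1)) P) - ent (push (hybrid i.1) P))
      = ent (push (fun a => (a.1.2, a.2)) P) - ent (push (fun a => (a.1.1, a.2)) P) := by
    rw [Fin.sum_univ_eq_sum_range
      (fun c => ent (push (hybrid (c + 1)) P) - ent (push (hybrid c) P)) n,
      Finset.sum_range_sub (fun c => ent (push (hybrid c) P)), ent_hybrid_zero, ent_hybrid_last]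
  simp only [hterm]
  rw [Finset.sum_add_distrib, htel, Finset.sum_sub_distrib, ← hX, ← hY, sum_snd_eq_push, sum_fst_eq_push]
  simp only [mi, margA_eq_push, margB_eq_push, push_push]
  ring

end RatePrivacy
end
end

section
/- Let P and Q be probability distributions on 𝒳 = {±1, ±2, …, ±k} with Q(x) = P(−x) and P(x) > 0 for all x, and suppose P ≠ Q. For λ ∈ (0,1), set R_λ := λP + (1−λ)Q. Then for every λ ∈ (0, 1/2), D(P‖R_{1−λ})·(−log λ) < D(P‖R_λ)·(−log(1−λ)) (equivalently D(P‖R_{1−λ})/D(P‖R_λ) < log(1−λ)/log(λ)), and for every λ ∈ (1/2, 1) the reverse strict inequality D(P‖R_{1−λ})·(−log λ) > D(P‖R_λ)·(−log(1−λ)) holds. -/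
open scoped BigOperators

noncomputable section

namespace RatePrivacy

/-- The alphabet `𝒳 = {±1, …, ±k}` viewed as a finite set of integers. -/
def symAlphabet (k : ℕ) : Finset ℤ := (Finset.Icc (-(k : ℤ)) (k : ℤ)).erase 0

/-- `D(P ‖ R_lam)` where `R_lam = lam·P + (1−lam)·Q` and `Q(x) = P(−x)`, with logarithms
in base `b`, the sum running over `𝒳 = {±1, …, ±k}`. -/
def klMix (k : ℕ) (b : ℝ) (P : ℤ → ℝ) (lam : ℝ) : ℝ :=
  ∑ x ∈ symAlphabet k, P x * Real.logb b (P x / (lam * P x + (1 - lam) * P (-x)))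

/-- Monotonicity of a quotient of power series whose coefficient quotients strictly increase. -/
lemma mul_lt_mul_of_hasSum_pow {a c : ℕ → ℝ} {x y A B A' B' : ℝ}
    (hx : 0 < x) (hxy : x < y) (hc : ∀ n, 0 < c n) (hmono : StrictMono fun n => a n / c n)
    (hA : HasSum (fun n => a n * x ^ (n + 1)) A) (hB : HasSum (fun n => c n * x ^ (n + 1)) B)
    (hA' : HasSum (fun n => a n * y ^ (n + 1)) A')
    (hB' : HasSum (fun n => c n * y ^ (n + 1)) B') :
    A * B' < A' * B := by
  have hy : 0 < y := hx.trans hxy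
  have hB'pos : 0 < B' := by
    have hterm : ∀ n, 0 < c n * y ^ (n + 1) := fun n => mul_pos (hc n) (pow_pos hy _)
    exact hasSum_lt (fun n => (hterm n).le) (hterm 0) hasSum_zero hB'
  set ρ := A' / B' with hρ
  have hρA : A' - ρ * B' = 0 := by rw [hρ]; field_simp; ring
  have hy0 : HasSum (fun n => (a n - ρ * c n) * y ^ (n + 1)) 0 := by
    rw [← hρA]
    exact (hA'.sub (hB'.mul_left ρ)).congr_fun fun n => by ring
  have hxs : HasSum (fun n => (a n - ρ * c n) * x ^ (n + 1)) (A - ρ * B) :=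
    (hA.sub (hB.mul_left ρ)).congr_fun fun n => by ring
  have hex : ∃ n, ρ ≤ a n / c n := by
    by_contra! h
    have hneg : ∀ n, (a n - ρ * c n) * y ^ (n + 1) < 0 := fun n =>
      mul_neg_of_neg_of_pos (by have := (div_lt_iff₀ (hc n)).1 (h n); linarith) (pow_pos hy _)
    exact lt_irrefl _ (hasSum_lt (fun n => (hneg n).le) (hneg 0) hy0 hasSum_zero)
  classical
  let N := Nat.find hex
  set r := x / y with hr
  have hr0 : 0 < r := div_pos hx hy
  have hr1 : r < 1 := (div_lt_one hy).2 hxy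
  have hry : ∀ n, x ^ n = r ^ n * y ^ n := fun n => by rw [← mul_pow, hr, div_mul_cancel₀ _ hy.ne']
  have hafter : ∀ n, N < n →
      (a n - ρ * c n) * x ^ (n + 1) < r ^ (N + 1) * ((a n - ρ * c n) * y ^ (n + 1)) := by
    intro n hn
    have h1 : ρ < a n / c n := (Nat.find_spec hex).trans_lt (hmono hn)
    have h2 : 0 < a n - ρ * c n := by have := (lt_div_iff₀ (hc n)).1 h1; linarith
    have h3 : r ^ (n + 1) < r ^ (N + 1) := pow_lt_pow_right_of_lt_one₀ hr0 hr1 (by omega)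
    have h4 := mul_lt_mul_of_pos_right h3 (mul_pos h2 (pow_pos hy (n + 1)))
    rw [hry]
    linarith
  have hle : ∀ n,
      (a n - ρ * c n) * x ^ (n + 1) ≤ r ^ (N + 1) * ((a n - ρ * c n) * y ^ (n + 1)) := by
    intro n
    rcases lt_trichotomy n N with hn | hn | hn
    · have h1 : a n / c n < ρ := not_le.1 (Nat.find_min hex hn)
      have h2 : a n - ρ * c n < 0 := by have := (div_lt_iff₀ (hc n)).1 h1; linarith
      have h3 : r ^ (N + 1) ≤ r ^ (n + 1) := pow_le_pow_of_le_one hr0.le hr1.le (by omega)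
      have h4 := mul_le_mul_of_nonpos_right h3
        (mul_neg_of_neg_of_pos h2 (pow_pos hy (n + 1))).le
      rw [hry]
      linarith
    · rw [hry, hn]
      exact le_of_eq (by ring)
    · exact (hafter n hn).le
  have hlt := hasSum_lt hle (hafter (N + 1) N.lt_succ_self) hxs (hy0.mul_left _)
  rw [mul_zero, sub_neg, hρ, div_mul_eq_mul_div, lt_div_iff₀ hB'pos] at hlt
  exact hlt

/-- Twice the even part in `s` of the divergence of `(1 ± t) / 2` from `(1 ± s * t) / 2`. -/
def evenPart (s t : ℝ) : ℝ :=
  (1 + t) * Real.log (1 + t) + (1 - t) * Real.log (1 - t) - Real.log (1 - (s * t) ^ 2)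

/-- Twice the odd part in `s` of the divergence of `(1 ± t) / 2` from `(1 ∓ s * t) / 2`. -/
def oddPart (s t : ℝ) : ℝ := t * (Real.log (1 + s * t) - Real.log (1 - s * t))

lemma log_one_sub_sq {t : ℝ} (h0 : 0 < t) (h1 : t < 1) :
    Real.log (1 - t ^ 2) = Real.log (1 + t) + Real.log (1 - t) := by
  rw [← Real.log_mul (by linarith) (by linarith)]
  congr 1
  ring

lemma hasSum_evenPart {s t : ℝ} (hs0 : 0 < s) (hs1 : s < 1) (ht0 : 0 < t) (ht1 : t < 1) :
    HasSum (fun n : ℕ => ((1 + (2 * n + 1) * s ^ (2 * n + 2)) / ((n + 1) * (2 * n + 1)))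
      * (t ^ 2) ^ (n + 1)) (evenPart s t) := by
  have hst : s * t < 1 := by nlinarith
  have hst0 : 0 < s * t := mul_pos hs0 ht0
  have h1 := (Real.hasSum_log_sub_log_of_abs_lt_one (abs_lt.2 ⟨by linarith, ht1⟩)).mul_left t
  have h2 := Real.hasSum_pow_div_log_of_abs_lt_one
    (x := t ^ 2) (abs_lt.2 ⟨by nlinarith, by nlinarith⟩)
  have h3 := Real.hasSum_pow_div_log_of_abs_lt_one
    (x := (s * t) ^ 2) (abs_lt.2 ⟨by nlinarith, by nlinarith⟩)
  have hval : evenPart s t = t * (Real.log (1 + t) - Real.log (1 - t))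
      - -Real.log (1 - t ^ 2) + -Real.log (1 - (s * t) ^ 2) := by
    rw [evenPart, log_one_sub_sq ht0 ht1]
    ring
  rw [hval]
  refine ((h1.sub h2).add h3).congr_fun fun n => ?_
  have : (n : ℝ) + 1 ≠ 0 := by positivity
  have : 2 * (n : ℝ) + 1 ≠ 0 := by positivity
  field_simp
  ring

lemma hasSum_oddPart {s t : ℝ} (hs0 : 0 < s) (hs1 : s < 1) (ht0 : 0 < t) (ht1 : t < 1) :
    HasSum (fun n : ℕ => (2 * s ^ (2 * n + 1) / (2 * n + 1)) * (t ^ 2) ^ (n + 1))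
      (oddPart s t) := by
  have hst : s * t < 1 := by nlinarith
  have hst0 : 0 < s * t := mul_pos hs0 ht0
  have h1 := (Real.hasSum_log_sub_log_of_abs_lt_one
    (abs_lt.2 ⟨by linarith, hst⟩)).mul_left t
  exact h1.congr_fun fun n => by ring

lemma strictMono_coeff_div {s : ℝ} (hs0 : 0 < s) (hs1 : s < 1) :
    StrictMono fun n : ℕ => ((1 + (2 * n + 1) * s ^ (2 * n + 2)) / ((n + 1) * (2 * n + 1)))
      / (2 * s ^ (2 * n + 1) / (2 * n + 1) : ℝ) := by
  refine strictMono_nat_of_lt_succ fun n => ?_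
  have hbern : ((n : ℝ) + 2) * s ^ 2 - (n + 1) < s ^ (2 * n + 2) * s ^ 2 := by
    have h := one_add_mul_self_lt_rpow_one_add (s := s ^ 2 - 1) (p := (n : ℝ) + 2)
      (by nlinarith [sq_nonneg s]) (by nlinarith) (by linarith [n.cast_nonneg (α := ℝ)])
    rw [add_sub_cancel, show (n : ℝ) + 2 = ((n + 2 : ℕ) : ℝ) by push_cast; ring,
      Real.rpow_natCast, ← pow_mul] at h
    push_cast at h
    calc ((n : ℝ) + 2) * s ^ 2 - (n + 1) = 1 + (n + 2) * (s ^ 2 - 1) := by ring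
      _ < s ^ (2 * (n + 2)) := h
      _ = _ := by ring
  have hn : (0 : ℝ) < n + 1 := by positivity
  have hn' : (0 : ℝ) < n + 2 := by positivity
  have hsp : 0 < s ^ (2 * n + 1) := pow_pos hs0 _
  have e1 : ((1 + (2 * n + 1) * s ^ (2 * n + 2)) / ((n + 1) * (2 * n + 1)))
      / (2 * s ^ (2 * n + 1) / (2 * n + 1) : ℝ)
      = (1 + (2 * n + 1) * s ^ (2 * n + 2)) / (2 * (n + 1) * s ^ (2 * n + 1)) := by
    field_simp
  have e2 : ((1 + (2 * (n + 1 : ℕ) + 1) * s ^ (2 * (n + 1) + 2))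
        / (((n + 1 : ℕ) + 1) * (2 * (n + 1 : ℕ) + 1)))
      / (2 * s ^ (2 * (n + 1) + 1) / (2 * (n + 1 : ℕ) + 1) : ℝ)
      = (1 + (2 * n + 3) * (s ^ (2 * n + 2) * s ^ 2))
        / (2 * (n + 2) * (s ^ (2 * n + 1) * s ^ 2)) := by
    have : (0 : ℝ) < 2 * n + 3 := by positivity
    push_cast
    rw [show (2 : ℝ) * (n + 1) + 1 = 2 * n + 3 by ring, show (n : ℝ) + 1 + 1 = n + 2 by ring,
      show 2 * (n + 1) + 2 = 2 * n + 2 + 2 by ring, show 2 * (n + 1) + 1 = 2 * n + 1 + 2 by ring,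
      pow_add s (2 * n + 2) 2, pow_add s (2 * n + 1) 2]
    field_simp
  simp only [e1, e2]
  rw [div_lt_div_iff₀ (by positivity) (by positivity)]
  have key : (1 + (2 * n + 1) * s ^ (2 * n + 2)) * ((n + 2) * s ^ 2)
      < (1 + (2 * n + 3) * (s ^ (2 * n + 2) * s ^ 2)) * (n + 1 : ℝ) := by
    linarith
  have := mul_lt_mul_of_pos_right key (mul_pos two_pos hsp)
  linarith

lemma evenPart_mul_oddPart_lt {s t u : ℝ} (hs0 : 0 < s) (hs1 : s < 1) (ht0 : 0 < t)
    (htu : t < u) (hu1 : u < 1) :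
    evenPart s t * oddPart s u < evenPart s u * oddPart s t := by
  have hu0 := ht0.trans htu
  have ht1 := htu.trans hu1
  exact mul_lt_mul_of_hasSum_pow (by positivity) (by nlinarith) (fun n => by positivity)
    (strictMono_coeff_div hs0 hs1) (hasSum_evenPart hs0 hs1 ht0 ht1)
    (hasSum_oddPart hs0 hs1 ht0 ht1) (hasSum_evenPart hs0 hs1 hu0 hu1)
    (hasSum_oddPart hs0 hs1 hu0 hu1)

lemma oddPart_pos {s t : ℝ} (hs0 : 0 < s) (hs1 : s < 1) (ht0 : 0 < t) (ht1 : t ≤ 1) :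
    0 < oddPart s t := by
  have hst0 : 0 < s * t := mul_pos hs0 ht0
  exact mul_pos ht0 (sub_pos.2 (Real.log_lt_log (by nlinarith) (by linarith)))

lemma evenPart_mul_oddPart_one_lt {s t : ℝ} (hs0 : 0 < s) (hs1 : s < 1) (ht0 : 0 < t)
    (ht1 : t < 1) :
    evenPart s t * oddPart s 1 < evenPart s 1 * oddPart s t := by
  obtain ⟨v, htv, hv1⟩ := exists_between ht1
  have hv0 := ht0.trans htv
  have hstep := evenPart_mul_oddPart_lt hs0 hs1 ht0 htv hv1
  have hE : Filter.Tendsto (evenPart s) (nhdsWithin 1 (Set.Iio 1)) (nhds (evenPart s 1)) := by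
    refine ContinuousAt.continuousWithinAt ?_
    unfold evenPart
    refine ContinuousAt.sub (ContinuousAt.add ?_ ?_) ?_
    · exact (Real.continuous_mul_log.comp (continuous_const.add continuous_id)).continuousAt
    · exact (Real.continuous_mul_log.comp (continuous_const.sub continuous_id)).continuousAt
    · exact ContinuousAt.log (by fun_prop) (by nlinarith)
  have hO : Filter.Tendsto (oddPart s) (nhdsWithin 1 (Set.Iio 1)) (nhds (oddPart s 1)) := by
    refine ContinuousAt.continuousWithinAt ?_
    unfold oddPart
    refine ContinuousAt.mul continuousAt_id (ContinuousAt.sub ?_ ?_)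
    · exact ContinuousAt.log (by fun_prop) (by linarith)
    · exact ContinuousAt.log (by fun_prop) (by linarith)
  have hlim : evenPart s v * oddPart s 1 ≤ evenPart s 1 * oddPart s v := by
    refine le_of_tendsto_of_tendsto (hO.const_mul _) (hE.mul_const _) ?_
    filter_upwards [Ioo_mem_nhdsLT hv1] with u hu
    exact (evenPart_mul_oddPart_lt hs0 hs1 hv0 hu.1 hu.2).le
  have hOt := oddPart_pos hs0 hs1 ht0 ht1.le
  have hOv := oddPart_pos hs0 hs1 hv0 hv1.le
  have hO1 := oddPart_pos hs0 hs1 one_pos le_rfl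
  rw [← div_lt_div_iff₀ hOt hO1]
  exact ((div_lt_div_iff₀ hOt hOv).2 hstep).trans_le ((div_le_div_iff₀ hOv hO1).2 hlim)

/-- The contribution of the pair `{x, -x}` to the divergence, with `p = P x` and `q = P (-x)`. -/
def pairDiv (p q lam : ℝ) : ℝ :=
  p * Real.log (p / (lam * p + (1 - lam) * q)) + q * Real.log (q / (lam * q + (1 - lam) * p))

lemma pairDiv_comm (p q lam : ℝ) : pairDiv p q lam = pairDiv q p lam := add_comm _ _

lemma pairDiv_self (p lam : ℝ) : pairDiv p p lam = 0 := by
  have h : lam * p + (1 - lam) * p = p := by ring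
  by_cases hp : p = 0 <;> simp [pairDiv, h, hp]

lemma pairDiv_eq {c s t : ℝ} (hc : 0 < c) (hs0 : -1 < s) (hs1 : s < 1) (ht0 : 0 < t)
    (ht1 : t < 1) :
    pairDiv (c * (1 + t)) (c * (1 - t)) ((1 - s) / 2) = c * (evenPart s t + oddPart s t) := by
  have h1 : 0 < 1 - s * t := by nlinarith
  have h2 : 0 < 1 + s * t := by nlinarith
  have h3 : 0 < 1 + t := by linarith
  have h4 : 0 < 1 - t := by linarith
  have e1 : c * (1 + t) / ((1 - s) / 2 * (c * (1 + t)) + (1 - (1 - s) / 2) * (c * (1 - t)))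
      = (1 + t) / (1 - s * t) := by
    rw [show (1 - s) / 2 * (c * (1 + t)) + (1 - (1 - s) / 2) * (c * (1 - t))
      = c * (1 - s * t) by ring, mul_div_mul_left _ _ hc.ne']
  have e2 : c * (1 - t) / ((1 - s) / 2 * (c * (1 - t)) + (1 - (1 - s) / 2) * (c * (1 + t)))
      = (1 - t) / (1 + s * t) := by
    rw [show (1 - s) / 2 * (c * (1 - t)) + (1 - (1 - s) / 2) * (c * (1 + t))
      = c * (1 + s * t) by ring, mul_div_mul_left _ _ hc.ne']
  have e3 : Real.log (1 - (s * t) ^ 2) = Real.log (1 + s * t) + Real.log (1 - s * t) := by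
    rw [← Real.log_mul h2.ne' h1.ne']
    congr 1
    ring
  rw [pairDiv, e1, e2, Real.log_div h3.ne' h1.ne', Real.log_div h4.ne' h2.ne', evenPart,
    oddPart, e3]
  ring

lemma pairDiv_mul_lt_of_lt {p q lam : ℝ} (hq : 0 < q) (hqp : q < p) (h0 : 0 < lam)
    (h1 : lam < 1 / 2) :
    pairDiv p q (1 - lam) * (-Real.log lam) < pairDiv p q lam * (-Real.log (1 - lam)) := by
  obtain ⟨s, hs⟩ : ∃ s, s = 1 - 2 * lam := ⟨_, rfl⟩
  obtain ⟨c, hc⟩ : ∃ c, c = (p + q) / 2 := ⟨_, rfl⟩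
  obtain ⟨t, ht⟩ : ∃ t, t = (p - q) / (p + q) := ⟨_, rfl⟩
  have hs0 : 0 < s := by linarith
  have hs1 : s < 1 := by linarith
  have hpq : 0 < p + q := by linarith
  have hc0 : 0 < c := by linarith
  have ht0 : 0 < t := ht ▸ div_pos (by linarith) hpq
  have ht1 : t < 1 := ht ▸ (div_lt_one hpq).2 (by linarith)
  have hp' : p = c * (1 + t) := by rw [hc, ht]; field_simp; ring
  have hq' : q = c * (1 - t) := by rw [hc, ht]; field_simp; ring
  have hl : lam = (1 - s) / 2 := by rw [hs]; ring
  have hl' : 1 - lam = (1 - -s) / 2 := by rw [hs]; ring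
  have h2 : pairDiv p q (1 - lam) = c * (evenPart s t - oddPart s t) := by
    rw [hp', hq', hl', pairDiv_eq hc0 (by linarith) (by linarith) ht0 ht1]
    simp only [evenPart, oddPart, neg_mul, neg_sq, sub_neg_eq_add, ← sub_eq_add_neg]
    ring
  have h3 : pairDiv p q lam = c * (evenPart s t + oddPart s t) := by
    rw [hp', hq', hl, pairDiv_eq hc0 (by linarith) hs1 ht0 ht1]
  have hE : evenPart s 1 = -Real.log lam - Real.log (1 - lam) := by
    rw [evenPart, mul_one, log_one_sub_sq hs0 hs1, hl, show 1 - (1 - s) / 2 = (1 + s) / 2 by ring,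
      Real.log_div (by linarith) two_ne_zero, Real.log_div (by linarith) two_ne_zero,
      one_add_one_eq_two]
    ring
  have hO : oddPart s 1 = Real.log (1 - lam) - Real.log lam := by
    rw [oddPart, mul_one, hl, show 1 - (1 - s) / 2 = (1 + s) / 2 by ring,
      Real.log_div (by linarith) two_ne_zero, Real.log_div (by linarith) two_ne_zero]
    ring
  have key := evenPart_mul_oddPart_one_lt hs0 hs1 ht0 ht1
  rw [hE, hO] at key
  rw [h2, h3, mul_assoc, mul_assoc]
  exact mul_lt_mul_of_pos_left (by linarith) hc0

lemma pairDiv_mul_lt {p q lam : ℝ} (hp : 0 < p) (hq : 0 < q) (hpq : p ≠ q) (h0 : 0 < lam)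
    (h1 : lam < 1 / 2) :
    pairDiv p q (1 - lam) * (-Real.log lam) < pairDiv p q lam * (-Real.log (1 - lam)) := by
  rcases lt_or_gt_of_ne hpq with h | h
  · rw [pairDiv_comm p q, pairDiv_comm p q]
    exact pairDiv_mul_lt_of_lt hp h h0 h1
  · exact pairDiv_mul_lt_of_lt hq h h0 h1

lemma neg_mem_symAlphabet {k : ℕ} {x : ℤ} (hx : x ∈ symAlphabet k) : -x ∈ symAlphabet k := by
  simp only [symAlphabet, Finset.mem_erase, Finset.mem_Icc] at hx ⊢
  omega

lemma two_mul_klMix (k : ℕ) (b : ℝ) (P : ℤ → ℝ) (lam : ℝ) :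
    2 * klMix k b P lam = (∑ x ∈ symAlphabet k, pairDiv (P x) (P (-x)) lam) / Real.log b := by
  have hneg : klMix k b P lam = ∑ x ∈ symAlphabet k,
      P (-x) * Real.logb b (P (-x) / (lam * P (-x) + (1 - lam) * P x)) := by
    refine Finset.sum_nbij' (fun x => -x) (fun x => -x) (fun x hx => neg_mem_symAlphabet hx)
      (fun x hx => neg_mem_symAlphabet hx) ?_ ?_ ?_ <;> simp
  rw [two_mul]
  nth_rewrite 2 [hneg]
  rw [klMix, ← Finset.sum_add_distrib, Finset.sum_div]
  refine Finset.sum_congr rfl fun x _ => ?_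
  simp only [pairDiv, Real.logb]
  ring

lemma klMix_mul_lt {k : ℕ} {b : ℝ} (hb : 1 < b) {P : ℤ → ℝ}
    (hpos : ∀ x ∈ symAlphabet k, 0 < P x) (hne : ∃ x ∈ symAlphabet k, P x ≠ P (-x))
    {lam : ℝ} (h0 : 0 < lam) (h1 : lam < 1 / 2) :
    klMix k b P (1 - lam) * (-(Real.logb b lam))
      < klMix k b P lam * (-(Real.logb b (1 - lam))) := by
  have hlb : 0 < Real.log b := Real.log_pos hb
  have key : (∑ x ∈ symAlphabet k, pairDiv (P x) (P (-x)) (1 - lam)) * (-Real.log lam)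
      < (∑ x ∈ symAlphabet k, pairDiv (P x) (P (-x)) lam) * (-Real.log (1 - lam)) := by
    rw [Finset.sum_mul, Finset.sum_mul]
    obtain ⟨y, hy, hPy⟩ := hne
    refine Finset.sum_lt_sum (fun x hx => ?_)
      ⟨y, hy, pairDiv_mul_lt (hpos y hy) (hpos _ (neg_mem_symAlphabet hy)) hPy h0 h1⟩
    by_cases hP : P x = P (-x)
    · simp [← hP, pairDiv_self]
    · exact (pairDiv_mul_lt (hpos x hx) (hpos _ (neg_mem_symAlphabet hx)) hP h0 h1).le
  have hk (l : ℝ) : klMix k b P l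
      = (∑ x ∈ symAlphabet k, pairDiv (P x) (P (-x)) l) / Real.log b / 2 := by
    rw [← two_mul_klMix]
    ring
  have hkey := mul_lt_mul_of_pos_right key
    (show 0 < (Real.log b)⁻¹ * (Real.log b)⁻¹ / 2 by positivity)
  rw [hk, hk, Real.logb, Real.logb]
  simp only [div_eq_mul_inv] at hkey ⊢
  linarith

/-- Let `P` be a probability distribution on `𝒳 = {±1, …, ±k}` with
`P(x) > 0` for all `x`, and let `Q(x) = P(−x)`; suppose `P ≠ Q`.  For `lam ∈ (0,1)` set
`R_lam = lam·P + (1−lam)·Q`.  Then for every `lam ∈ (0, 1/2)`,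
`D(P‖R_{1−lam})·(−log lam) < D(P‖R_lam)·(−log(1−lam))`, and for every `lam ∈ (1/2, 1)`
the reverse strict inequality holds.  Logarithms are in an arbitrary fixed base `b > 1`. -/
theorem stmt9 (k : ℕ) (hk : 1 ≤ k) (b : ℝ) (hb : 1 < b) (P : ℤ → ℝ)
    (hpos : ∀ x ∈ symAlphabet k, 0 < P x)
    (hsum : ∑ x ∈ symAlphabet k, P x = 1)
    (hne : ∃ x ∈ symAlphabet k, P x ≠ P (-x)) :
    (∀ lam : ℝ, 0 < lam → lam < 1 / 2 →
      klMix k b P (1 - lam) * (-(Real.logb b lam))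
        < klMix k b P lam * (-(Real.logb b (1 - lam)))) ∧
    (∀ lam : ℝ, 1 / 2 < lam → lam < 1 →
      klMix k b P lam * (-(Real.logb b (1 - lam)))
        < klMix k b P (1 - lam) * (-(Real.logb b lam))) := by
  refine ⟨fun lam h0 h1 => klMix_mul_lt hb hpos hne h0 h1, fun lam h0 h1 => ?_⟩
  have h := klMix_mul_lt hb hpos hne (lam := 1 - lam) (by linarith) (by linarith)
  rwa [sub_sub_cancel] at h

end RatePrivacy
end
end
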